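/- Let q = 2^d be a power of 2 with (q,n) ≠ (2,5), and let n ≥ 5 be odd. Then there exists z ∈ F_{q^{2n}} with z^{qⁿ+1} = 1, Tr_{F_{q^{2n}}/F_{q^2}}(z) = 1, and z ≠ 1. -/

import Mathlib

open Polynomial in
theorem card_nthRootsFinset_one_of_dvd {F : Type*} [Field F] [Fintype F] {N : ℕ}
    (h : N ∣ Fintype.card F - 1) : (nthRootsFinset N (1 : F)).card = N := by
  classical
  obtain ⟨g, hg⟩ := IsCyclic.exists_ofOrder_eq_natCard (α := Fˣ)
  rw [Nat.card_eq_fintype_card, Fintype.card_units] at hg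
  obtain ⟨k, hk⟩ := h
  have hpos : 0 < Fintype.card F - 1 := by
    have := Fintype.one_lt_card (α := F); omega
  have hgp : IsPrimitiveRoot (g : F) (Fintype.card F - 1) := by
    rw [← hg]
    exact (IsPrimitiveRoot.orderOf g).map_of_injective (f := Units.coeHom F) Units.val_injective
  exact (hgp.pow hpos (by rw [hk, mul_comm])).card_nthRootsFinset

/-- A nontrivial `±1`-valued additive character that is invariant under the absolute Frobenius. -/
theorem exists_addChar_int_pow_two (F : Type*) [Field F] [Fintype F] [CharP F 2] :
    ∃ ψ : AddChar F ℤ, (∀ x, ψ (x ^ 2) = ψ x) ∧ ∃ a, ψ a = -1 := by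
  classical
  let : Algebra (ZMod 2) F := ZMod.algebra F 2
  refine ⟨(AddChar.zmodChar 2 (ζ := (-1 : ℤ)) (by norm_num)).compAddMonoidHom
    (Algebra.trace (ZMod 2) F).toAddMonoidHom, fun x => ?_, ?_⟩
  · have h := Algebra.trace_eq_of_algEquiv (FiniteField.frobeniusAlgEquiv (ZMod 2) F 2) x
    have h' : Algebra.trace (ZMod 2) F (x ^ 2) = Algebra.trace (ZMod 2) F x := by
      rw [← h]; simp
    simp [AddChar.compAddMonoidHom_apply, h']
  · obtain ⟨a, ha⟩ := Algebra.trace_surjective (ZMod 2) F 1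
    exact ⟨a, by simp [AddChar.compAddMonoidHom_apply, ha, AddChar.zmodChar_apply]; decide⟩

theorem AddChar.sq_eq_one_of_charTwo {F : Type*} [Field F] [CharP F 2] (ψ : AddChar F ℤ) (x : F) :
    ψ x ^ 2 = 1 := by
  rw [sq, ← AddChar.map_add_eq_mul, CharTwo.add_self_eq_zero, AddChar.map_zero_eq_one]

theorem AddChar.sum_eq_zero_of_add_mem {F : Type*} [Field F] [CharP F 2] (ψ : AddChar F ℤ)
    (L : Finset F) {a : F} (ha : ψ a = -1) (hL : ∀ x ∈ L, x + a ∈ L) : ∑ x ∈ L, ψ x = 0 := by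
  refine Finset.sum_involution (fun x _ => x + a) (fun x _ => ?_) (fun x _ _ h => ?_)
    (fun x hx => hL x hx) (fun x _ => ?_)
  · rw [AddChar.map_add_eq_mul, ha]; ring
  · have h0 : a = 0 := by simpa using h
    rw [h0, AddChar.map_zero_eq_one] at ha
    norm_num at ha
  · rw [add_assoc, CharTwo.add_self_eq_zero, add_zero]

theorem AddChar.sum_mul_eq_ite {F : Type*} [Field F] [CharP F 2] [DecidableEq F]
    (ψ : AddChar F ℤ) (L : Finset F) {a : F} (ha : ψ a = -1) (haL : a ∈ L)
    (hadd : ∀ x ∈ L, ∀ y ∈ L, x + y ∈ L) (hmul : ∀ x ∈ L, ∀ y ∈ L, x * y ∈ L)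
    (hinv : ∀ x ∈ L, x⁻¹ ∈ L) (c : F) (hc : c ∈ L) :
    ∑ x ∈ L, ψ (x * c) = if c = 0 then (L.card : ℤ) else 0 := by
  split_ifs with h
  · simp [h]
  · rw [← ψ.sum_eq_zero_of_add_mem L ha fun x hx => hadd x hx a haL]
    refine Finset.sum_nbij' (fun x => x * c) (fun x => x * c⁻¹) (fun x hx => hmul x hx c hc)
      (fun x hx => hmul x hx _ (hinv c hc)) (fun x _ => ?_) (fun x _ => ?_) (fun x _ => rfl)
    · field_simp
    · field_simp

/-- Orthogonality: a correlation of two character sums counts coincidences. -/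
theorem AddChar.sum_mul_sum_eq_card {F : Type*} [Field F] [CharP F 2] [DecidableEq F]
    (ψ : AddChar F ℤ) (L : Finset F) {S S' : Type*} (A : Finset S) (B : Finset S')
    (f : S → F) (g : S' → F)
    (h : ∀ s ∈ A, ∀ t ∈ B, ∑ x ∈ L, ψ (x * (f s + g t))
      = if f s + g t = 0 then (L.card : ℤ) else 0) :
    ∑ x ∈ L, (∑ s ∈ A, ψ (x * f s)) * (∑ t ∈ B, ψ (x * g t))
      = L.card * ((A ×ˢ B).filter fun p => f p.1 = g p.2).card := by
  simp_rw [Finset.sum_mul_sum, ← AddChar.map_add_eq_mul, ← mul_add]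
  rw [Finset.sum_comm]
  simp_rw [Finset.sum_comm (s := L)]
  rw [Finset.sum_congr rfl fun s hs => Finset.sum_congr rfl fun t ht => h s hs t ht]
  rw [← Finset.sum_product', Finset.card_filter]
  simp [CharTwo.add_eq_zero, ← Finset.sum_filter, mul_comm]

open Polynomial in
/-- The fourth-moment energy of the unit circle `z ^ (Q + 1) = 1`. -/
theorem card_add_eq_add_le {F : Type*} [Field F] [CharP F 2] [DecidableEq F] (m : ℕ) :
    ((((nthRootsFinset (2 ^ m + 1) (1 : F)) ×ˢ (nthRootsFinset (2 ^ m + 1) (1 : F))) ×ˢ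
      ((nthRootsFinset (2 ^ m + 1) (1 : F)) ×ˢ (nthRootsFinset (2 ^ m + 1) (1 : F)))).filter
        fun p => p.1.1 + p.1.2 = p.2.1 + p.2.2).card
      ≤ 3 * (nthRootsFinset (2 ^ m + 1) (1 : F)).card ^ 2 := by
  set U := nthRootsFinset (2 ^ m + 1) (1 : F) with hU
  have hmem : ∀ z ∈ U, z ^ 2 ^ m * z = 1 := fun z hz => by
    rw [hU, mem_nthRootsFinset (Nat.succ_pos _)] at hz
    rw [← pow_succ, hz]
  have hsub : ((U ×ˢ U) ×ˢ (U ×ˢ U)).filter (fun p => p.1.1 + p.1.2 = p.2.1 + p.2.2) ⊆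
      (U ×ˢ U).image (fun p => ((p.1, p.1), (p.2, p.2))) ∪
      ((U ×ˢ U).image (fun p => ((p.1, p.2), (p.1, p.2))) ∪
      (U ×ˢ U).image (fun p => ((p.1, p.2), (p.2, p.1)))) := by
    rintro ⟨⟨a, b⟩, ⟨c, e⟩⟩ hp
    simp only [Finset.mem_filter, Finset.mem_product] at hp
    obtain ⟨⟨⟨ha, hb⟩, hc, he⟩, h⟩ := hp
    have he' : e = a + b + c := by
      rw [h, add_comm c e, add_assoc, CharTwo.add_self_eq_zero, add_zero]
    have key : (a + b) * (a + c) * (b + c) = 0 := by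
      have h1 := hmem a ha
      have h2 := hmem b hb
      have h3 := hmem c hc
      have h4 := hmem e he
      rw [he', add_pow_char_pow, add_pow_char_pow] at h4
      generalize a ^ 2 ^ m = A at *
      generalize b ^ 2 ^ m = B at *
      generalize c ^ 2 ^ m = C at *
      linear_combination (a * b * c) * h4 - (b * c * (a + b + c)) * h1
        - (a * c * (a + b + c)) * h2 - (a * b * (a + b + c)) * h3
    rw [mul_eq_zero, mul_eq_zero] at key
    simp only [CharTwo.add_eq_zero] at key
    simp only [Finset.mem_union, Finset.mem_image, Finset.mem_product, Prod.mk.injEq, Prod.exists]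
    rcases key with (k | k) | k
    · left
      refine ⟨a, c, ⟨ha, hc⟩, ⟨rfl, k⟩, rfl, ?_⟩
      rw [he', k, CharTwo.add_self_eq_zero, zero_add]
    · right; left
      refine ⟨a, b, ⟨ha, hb⟩, ⟨rfl, rfl⟩, k, ?_⟩
      rw [he', k, add_comm c b, add_assoc, CharTwo.add_self_eq_zero, add_zero]
    · right; right
      refine ⟨a, b, ⟨ha, hb⟩, ⟨rfl, rfl⟩, k, ?_⟩
      rw [he', k, add_assoc, CharTwo.add_self_eq_zero, add_zero]
  have hUU : (U ×ˢ U).card = U.card ^ 2 := by rw [Finset.card_product, sq]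
  calc _ ≤ _ := Finset.card_le_card hsub
    _ ≤ _ := Finset.card_union_le _ _
    _ ≤ U.card ^ 2 + (U.card ^ 2 + U.card ^ 2) := by
      refine add_le_add (hUU ▸ Finset.card_image_le)
        ((Finset.card_union_le _ _).trans (add_le_add ?_ ?_)) <;>
      exact hUU ▸ Finset.card_image_le
    _ = _ := by ring

/-- The trace map from `F_{q^{2n}}` to `F_{q^2}`, viewed inside `F_{q^{2n}}`. -/
def trSq {F : Type*} [Field F] (q n : ℕ) (z : F) : F := ∑ i ∈ Finset.range n, z ^ ((q ^ 2) ^ i)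

theorem pow_sq_pow_of_pow_sq_eq {F : Type*} [Field F] {q : ℕ} {a : F} (ha : a ^ (q ^ 2) = a)
    (i : ℕ) : a ^ ((q ^ 2) ^ i) = a := by
  induction i with
  | zero => simp
  | succ k ih => rw [pow_succ, pow_mul, ih, ha]

theorem trSq_mul {F : Type*} [Field F] {q : ℕ} (n : ℕ) {a : F} (ha : a ^ (q ^ 2) = a) (z : F) :
    trSq q n (a * z) = a * trSq q n z := by
  simp only [trSq, mul_pow, pow_sq_pow_of_pow_sq_eq ha, Finset.mul_sum]

theorem trSq_add {F : Type*} [Field F] [CharP F 2] {d q : ℕ} (hq : q = 2 ^ d) (n : ℕ) (x y : F) :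
    trSq q n (x + y) = trSq q n x + trSq q n y := by
  simp only [trSq, hq, ← pow_mul, add_pow_char_pow, Finset.sum_add_distrib]

theorem trSq_one {F : Type*} [Field F] [CharP F 2] (q : ℕ) {n : ℕ} (hn : Odd n) :
    trSq q n (1 : F) = 1 := by
  obtain ⟨k, rfl⟩ := hn
  simp [trSq, CharTwo.two_eq_zero]

theorem trSq_eq_self {F : Type*} [Field F] [CharP F 2] {q n : ℕ} (hn : Odd n) {a : F}
    (ha : a ^ (q ^ 2) = a) : trSq q n a = a := by
  simpa [trSq_one q hn] using trSq_mul n ha 1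

theorem trSq_pow {F : Type*} [Field F] [Fintype F] [CharP F 2] {d q n : ℕ} (hq : q = 2 ^ d)
    (hF : Fintype.card F = q ^ (2 * n)) (z : F) : trSq q n z ^ (q ^ 2) = trSq q n z := by
  have h : ∀ s : Finset ℕ, (∑ i ∈ s, z ^ ((q ^ 2) ^ i)) ^ (q ^ 2)
      = ∑ i ∈ s, z ^ ((q ^ 2) ^ (i + 1)) := fun s => by
    conv_lhs => rw [hq, ← pow_mul, sum_pow_char_pow, pow_mul, ← hq]
    simp only [← pow_mul, pow_succ]
  have hz : z ^ ((q ^ 2) ^ n) = z := by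
    rw [← pow_mul, ← hF, FiniteField.pow_card]
  have h1 := Finset.sum_range_succ (fun i => z ^ ((q ^ 2) ^ i)) n
  rw [Finset.sum_range_succ'] at h1
  simp only [pow_zero, pow_one, hz] at h1
  rw [trSq, h]
  exact add_right_cancel h1

theorem AddChar.apply_pow_two_pow {F : Type*} [Field F] {ψ : AddChar F ℤ}
    (hψ : ∀ x, ψ (x ^ 2) = ψ x) (x : F) (m : ℕ) : ψ (x ^ 2 ^ m) = ψ x := by
  induction m with
  | zero => simp
  | succ k ih => rw [pow_succ, pow_mul, hψ, ih]

theorem AddChar.apply_trSq {F : Type*} [Field F] [CharP F 2] {ψ : AddChar F ℤ}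
    (hψ : ∀ x, ψ (x ^ 2) = ψ x) {d q n : ℕ} (hq : q = 2 ^ d) (hn : Odd n) (z : F) :
    ψ (trSq q n z) = ψ z := by
  have h : ∀ m, ψ (trSq q m z) = ψ z ^ m := fun m => by
    induction m with
    | zero => simp [trSq]
    | succ k ih =>
      rw [pow_succ, ← ih, trSq, Finset.sum_range_succ, AddChar.map_add_eq_mul]
      refine congrArg₂ _ rfl ?_
      rw [hq, ← pow_mul, ← pow_mul, AddChar.apply_pow_two_pow hψ]
  obtain ⟨k, rfl⟩ := hn
  rw [h, pow_succ, pow_mul, ψ.sq_eq_one_of_charTwo, one_pow, one_mul]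

theorem gcd_sq_sub_one_pow_add_one_dvd {q n : ℕ} (hq : 0 < q) (hn : Odd n) :
    Nat.gcd (q ^ 2 - 1) (q ^ n + 1) ∣ q + 1 := by
  obtain ⟨k, rfl⟩ := hn
  have h1 : q ^ 2 - 1 ∣ (q ^ 2) ^ k - 1 := by
    simpa using Nat.sub_dvd_pow_sub_pow (q ^ 2) 1 k
  have h2 : q ^ (2 * k + 1) + 1 = q * ((q ^ 2) ^ k - 1) + (q + 1) := by
    have : 1 ≤ (q ^ 2) ^ k := Nat.one_le_pow _ _ (by positivity)
    obtain ⟨c, hc⟩ := Nat.exists_eq_add_of_le this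
    rw [pow_succ, pow_mul, hc]; simp; ring
  have hg := Nat.gcd_dvd_left (q ^ 2 - 1) (q ^ (2 * k + 1) + 1)
  have hg' := Nat.gcd_dvd_right (q ^ 2 - 1) (q ^ (2 * k + 1) + 1)
  rw [h2] at hg hg' ⊢
  exact (Nat.dvd_add_right ((hg.trans h1).mul_left q)).1 hg'

theorem sq_sub_one_dvd {q n : ℕ} : q ^ 2 - 1 ∣ q ^ (2 * n) - 1 := by
  simpa [pow_mul] using Nat.sub_dvd_pow_sub_pow (q ^ 2) 1 n

theorem pow_add_one_dvd {q n : ℕ} : q ^ n + 1 ∣ q ^ (2 * n) - 1 :=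
  ⟨q ^ n - 1, by rw [mul_comm 2 n, pow_mul, ← Nat.sq_sub_sq, one_pow]⟩

theorem add_one_dvd_pow_add_one {q n : ℕ} (hn : Odd n) : q + 1 ∣ q ^ n + 1 := by
  simpa using hn.nat_add_dvd_pow_add_pow q 1

theorem moment_bounds_incompatible {q Q A B C D : ℤ} (hq : 2 ≤ q) (hQ : q ^ 7 ≤ Q)
    (hA : A ≤ q ^ 2 * (q + 1) - (Q + 1) * (q + 1)) (hAB : A ^ 2 ≤ C * B)
    (hB : B = q ^ 2 * (q + 1) - (q + 1) ^ 2)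
    (hC : C ^ 2 ≤ (q ^ 2 - 1) * D)
    (hD : (Q + 1) * D ≤ (q + 1) * (Q ^ 2 * (3 * (Q + 1) ^ 2) - (Q + 1) ^ 4)) : False := by
  have hQ0 : 0 < Q := lt_of_lt_of_le (by positivity) hQ
  have hq2 : q ^ 2 ≤ q ^ 7 := pow_le_pow_right₀ (by linarith) (by norm_num)
  have hD' : D ≤ (q + 1) * (2 * Q ^ 3) := by
    have h1 : (Q + 1) * D ≤ (Q + 1) * ((q + 1) * (2 * Q ^ 3 - 3 * Q - 1)) := by
      refine hD.trans (le_of_eq ?_); ring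
    have h2 := le_of_mul_le_mul_left h1 (by linarith)
    nlinarith
  have hA1 : (q + 1) * (Q + 1 - q ^ 2) ≤ -A := by linarith
  have hP : 0 ≤ Q - q ^ 2 := by linarith
  have hA4 : ((q + 1) * (Q - q ^ 2)) ^ 4 ≤ A ^ 4 := by
    rw [← (by decide : Even 4).neg_pow A]
    refine pow_le_pow_left₀ (by positivity) ?_ 4
    nlinarith
  have hB' : B = (q + 1) * (q ^ 2 - q - 1) := by rw [hB]; ring
  have h4 : A ^ 4 ≤ C ^ 2 * B ^ 2 := by
    calc A ^ 4 = (A ^ 2) ^ 2 := by ring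
      _ ≤ (C * B) ^ 2 := pow_le_pow_left₀ (sq_nonneg A) hAB 2
      _ = _ := by ring
  have h5 : A ^ 4 ≤ (q + 1) ^ 4 * (2 * q ^ 5 * Q ^ 3) := by
    calc A ^ 4 ≤ C ^ 2 * B ^ 2 := h4
      _ ≤ ((q ^ 2 - 1) * ((q + 1) * (2 * Q ^ 3))) * B ^ 2 := by
        refine mul_le_mul_of_nonneg_right (hC.trans ?_) (sq_nonneg B)
        exact mul_le_mul_of_nonneg_left hD' (by nlinarith)
      _ = (q + 1) ^ 4 * (2 * Q ^ 3 * ((q - 1) * (q ^ 2 - q - 1) ^ 2)) := by rw [hB']; ring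
      _ ≤ (q + 1) ^ 4 * (2 * Q ^ 3 * (q * (q ^ 2) ^ 2)) := by
        gcongr
        · linarith
        · nlinarith
        · linarith
      _ = _ := by ring
  have h6 : (Q - q ^ 2) ^ 4 ≤ 2 * q ^ 5 * Q ^ 3 := by
    have := hA4.trans h5
    rw [mul_pow] at this
    exact le_of_mul_le_mul_left this (by positivity)
  have h7 : Q ^ 3 * (Q - 4 * q ^ 2) ≤ (Q - q ^ 2) ^ 4 := by
    have e : (Q - q ^ 2) ^ 4 - Q ^ 3 * (Q - 4 * q ^ 2)
        = (q ^ 2) ^ 2 * (4 * Q * (Q - q ^ 2) + 2 * Q ^ 2 + (q ^ 2) ^ 2) := by ring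
    have : 0 ≤ (q ^ 2) ^ 2 * (4 * Q * (Q - q ^ 2) + 2 * Q ^ 2 + (q ^ 2) ^ 2) := by positivity
    linarith
  have h8 : Q - 4 * q ^ 2 ≤ 2 * q ^ 5 := by
    refine le_of_mul_le_mul_left ((h7.trans h6).trans (le_of_eq ?_)) (pow_pos hQ0 3)
    ring
  have h9 : 4 * q ^ 2 < 2 * q ^ 5 := by
    have : (2 : ℤ) ^ 3 ≤ q ^ 3 := pow_le_pow_left₀ (by norm_num) hq 3
    nlinarith [pow_pos (show 0 < q by linarith) 2]
  have h10 : 4 * q ^ 5 ≤ q ^ 7 := by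
    have : (2 : ℤ) ^ 2 ≤ q ^ 2 := pow_le_pow_left₀ (by norm_num) hq 2
    nlinarith [pow_pos (show 0 < q by linarith) 5]
  linarith

open Polynomial in
theorem exists_trSq_eq_one_of_seven_le {F : Type*} [Field F] [Fintype F] [CharP F 2] {d q n : ℕ}
    (hd : 0 < d) (hq : q = 2 ^ d) (hn : Odd n) (hn7 : 7 ≤ n)
    (hF : Fintype.card F = q ^ (2 * n)) :
    ∃ z : F, z ^ (q ^ n + 1) = 1 ∧ trSq q n z = 1 ∧ z ≠ 1 := by
  classical
  by_contra! hcon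
  obtain ⟨ψ, hψ, a₀, ha₀⟩ := exists_addChar_int_pow_two F
  have hq2 : 2 ≤ q := by rw [hq]; exact Nat.le_self_pow hd.ne' 2
  have hq1 : 0 < q ^ 2 - 1 := by
    have : 2 ^ 2 ≤ q ^ 2 := Nat.pow_le_pow_left hq2 2
    omega
  set U := nthRootsFinset (q ^ n + 1) (1 : F) with hU
  set M := nthRootsFinset (q + 1) (1 : F) with hM
  set L' := nthRootsFinset (q ^ 2 - 1) (1 : F) with hL'
  set L := insert 0 L' with hL
  have mU : ∀ {z}, z ∈ U ↔ z ^ (q ^ n + 1) = 1 := mem_nthRootsFinset (Nat.succ_pos _) 1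
  have mM : ∀ {z}, z ∈ M ↔ z ^ (q + 1) = 1 := mem_nthRootsFinset (Nat.succ_pos _) 1
  have mL' : ∀ {z}, z ∈ L' ↔ z ^ (q ^ 2 - 1) = 1 := mem_nthRootsFinset hq1 1
  have hz0 : (0 : F) ∉ L' := by rw [mL', zero_pow hq1.ne']; exact zero_ne_one
  have mL : ∀ {z}, z ∈ L ↔ z ^ (q ^ 2) = z := fun {z} => by
    rw [hL, Finset.mem_insert, mL']
    obtain ⟨c, hc⟩ : ∃ c, q ^ 2 = c + 1 := ⟨q ^ 2 - 1, by omega⟩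
    rw [hc, Nat.add_sub_cancel, pow_succ]
    rcases eq_or_ne z 0 with rfl | h
    · simp
    · simp [h]
  have cU : U.card = q ^ n + 1 := card_nthRootsFinset_one_of_dvd (hF ▸ pow_add_one_dvd)
  have cL' : L'.card = q ^ 2 - 1 := card_nthRootsFinset_one_of_dvd (hF ▸ sq_sub_one_dvd)
  have cM : M.card = q + 1 := card_nthRootsFinset_one_of_dvd
    (((add_one_dvd_pow_add_one hn).trans pow_add_one_dvd).trans (hF ▸ dvd_rfl))
  have cL : L.card = q ^ 2 := by rw [hL, Finset.card_insert_of_notMem hz0, cL']; omega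
  have hMU : M ⊆ U := fun u hu => by
    rw [mU]; rw [mM] at hu
    obtain ⟨c, hc⟩ := add_one_dvd_pow_add_one (q := q) hn
    rw [hc, pow_mul, hu, one_pow]
  have hML : M ⊆ L := fun u hu => by
    rw [hL, Finset.mem_insert, mL']; rw [mM] at hu
    right
    have : q ^ 2 - 1 = (q + 1) * (q - 1) := by rw [← Nat.sq_sub_sq, one_pow]
    rw [this, pow_mul, hu, one_pow]
  have hT : ∀ z : F, trSq q n z ∈ L := fun z => mL.2 (trSq_pow hq hF z)
  have Ladd : ∀ x ∈ L, ∀ y ∈ L, x + y ∈ L := fun x hx y hy => by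
    rw [mL] at *
    rw [hq, ← pow_mul] at *
    rw [add_pow_char_pow, hx, hy]
  have Lmul : ∀ x ∈ L, ∀ y ∈ L, x * y ∈ L := fun x hx y hy => by
    rw [mL] at *
    rw [mul_pow, hx, hy]
  have Linv : ∀ x ∈ L, x⁻¹ ∈ L := fun x hx => by
    rw [mL] at *
    rw [inv_pow, hx]
  have orthL := ψ.sum_mul_eq_ite L (a := trSq q n a₀) (by rw [ψ.apply_trSq hψ hq hn, ha₀]) (hT a₀)
    Ladd Lmul Linv
  have orthF := ψ.sum_mul_eq_ite Finset.univ ha₀ (Finset.mem_univ _) (by simp) (by simp) (by simp)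
  set K : F → ℤ := fun x => ∑ z ∈ U, ψ (x * z) with hK
  set k : F → ℤ := fun x => ∑ u ∈ M, ψ (x * u) with hk
  have K0 : K 0 = q ^ n + 1 := by simp [hK, cU]
  have k0 : k 0 = q + 1 := by simp [hk, cM]
  have cross : ∑ a ∈ L, K a * k a ≤ q ^ 2 * (q + 1) := by
    have h1 := ψ.sum_mul_sum_eq_card L U M (trSq q n) id fun s _ t ht =>
      orthL _ (Ladd _ (hT s) _ (hML ht))
    have h2 : ∀ a ∈ L, ∑ z ∈ U, ψ (a * trSq q n z) = K a := fun a ha =>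
      Finset.sum_congr rfl fun z _ => by
        rw [← trSq_mul n (mL.1 ha), ψ.apply_trSq hψ hq hn]
    rw [Finset.sum_congr rfl fun a ha => by rw [h2 a ha]] at h1
    have h3 : ((U ×ˢ M).filter fun p => trSq q n p.1 = id p.2).card ≤ M.card := by
      refine Finset.card_le_card_of_injOn Prod.snd (fun p hp => ?_) fun p hp p' hp' h => ?_
      · simp only [Finset.coe_filter, Set.mem_ofPred_eq, Finset.mem_product] at hp
        exact hp.1.2
      · have key : ∀ p : F × F, p ∈ (U ×ˢ M).filter (fun p => trSq q n p.1 = id p.2) →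
            p.1 = p.2 := fun p hp => by
          simp only [Finset.mem_filter, Finset.mem_product, id] at hp
          obtain ⟨⟨hp1, hp2⟩, hp3⟩ := hp
          have hne : p.2 ≠ 0 := by
            rintro h0
            rw [mM, h0, zero_pow (Nat.succ_ne_zero _)] at hp2
            exact zero_ne_one hp2
          have := hcon (p.2⁻¹ * p.1) (by
            rw [mul_pow, inv_pow, mU.1 hp1, mU.1 (hMU hp2), inv_one, one_mul]) (by
            rw [trSq_mul n (mL.1 (Linv _ (hML hp2))), hp3, inv_mul_cancel₀ hne])
          field_simp at this
          exact this
        have e1 := key p hp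
        have e2 := key p' hp'
        exact Prod.ext (by rw [e1, e2, h]) h
    calc _ = _ := h1
      _ ≤ (L.card : ℤ) * M.card := by gcongr
      _ = _ := by rw [cL, cM]; push_cast; ring
  have second : ∑ a ∈ L, k a ^ 2 = q ^ 2 * (q + 1) := by
    have h1 := ψ.sum_mul_sum_eq_card L M M id id fun s hs t ht =>
      orthL _ (Ladd _ (hML hs) _ (hML ht))
    have h2 : ((M ×ˢ M).filter fun p => id p.1 = id p.2) = M.diag := by
      ext p; simp [Finset.mem_diag]; grind
    rw [h2, Finset.diag_card, cM, cL] at h1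
    simp only [sq (k _)]
    refine h1.trans (by push_cast; ring)
  have fourth : ∑ x : F, K x ^ 4 ≤ q ^ (2 * n) * (3 * (q ^ n + 1) ^ 2) := by
    have h1 := ψ.sum_mul_sum_eq_card Finset.univ (U ×ˢ U) (U ×ˢ U) (fun p => p.1 + p.2)
      (fun p => p.1 + p.2) fun s _ t _ => orthF _ (Finset.mem_univ _)
    have h2 : ∀ x, ∑ p ∈ U ×ˢ U, ψ (x * (p.1 + p.2)) = K x ^ 2 := fun x => by
      simp_rw [mul_add, AddChar.map_add_eq_mul]
      rw [Finset.sum_product, sq, hK, Finset.sum_mul_sum]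
    simp_rw [h2, ← sq, ← pow_mul] at h1
    have h3 := card_add_eq_add_le (F := F) (d * n)
    rw [pow_mul, ← hq, ← hU, cU] at h3
    rw [h1, Finset.card_univ, hF]
    push_cast
    gcongr
    exact_mod_cast h3
  have fiber : ∀ x : F, ((L' ×ˢ U).filter fun p => p.1 * p.2 = x).card ≤ q + 1 := fun x => by
    rcases ((L' ×ˢ U).filter fun p => p.1 * p.2 = x).eq_empty_or_nonempty with h | ⟨⟨a, u⟩, hau⟩
    · rw [h]; simp
    rw [← cM]
    simp only [Finset.mem_filter, Finset.mem_product] at hau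
    obtain ⟨⟨ha, hu⟩, hx⟩ := hau
    have ha0 : a ≠ 0 := fun h => hz0 (h ▸ ha)
    have hu0 : u ≠ 0 := fun h => by
      rw [mU, h, zero_pow (Nat.succ_ne_zero _)] at hu
      exact zero_ne_one hu
    refine Finset.card_le_card_of_injOn (fun p => p.1 * a⁻¹) (fun p hp => ?_) fun p hp p' hp' h => ?_
    · simp only [Finset.coe_filter, Set.mem_ofPred_eq, Finset.mem_product] at hp
      obtain ⟨⟨hp1, hp2⟩, hp3⟩ := hp
      have hp0 : p.2 ≠ 0 := fun h => by
        rw [mU, h, zero_pow (Nat.succ_ne_zero _)] at hp2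
        exact zero_ne_one hp2
      have e : p.1 * a⁻¹ = u * p.2⁻¹ := by
        field_simp
        rw [hp3, ← hx, mul_comm]
      have e1 : (p.1 * a⁻¹) ^ (q ^ 2 - 1) = 1 := by
        rw [mul_pow, inv_pow, mL'.1 hp1, mL'.1 ha]; simp
      have e2 : (p.1 * a⁻¹) ^ (q ^ n + 1) = 1 := by
        rw [e, mul_pow, inv_pow, mU.1 hu, mU.1 hp2]; simp
      exact mM.2 (orderOf_dvd_iff_pow_eq_one.1 ((Nat.dvd_gcd (orderOf_dvd_iff_pow_eq_one.2 e1)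
        (orderOf_dvd_iff_pow_eq_one.2 e2)).trans
          (gcd_sq_sub_one_pow_add_one_dvd (by omega) hn)))
    · simp only [Finset.coe_filter, Set.mem_ofPred_eq, Finset.mem_product] at hp hp'
      have e1 : p.1 = p'.1 := mul_right_cancel₀ (inv_ne_zero ha0) h
      have hp0 : p.1 ≠ 0 := fun h => hz0 (h ▸ hp.1.1)
      refine Prod.ext e1 (mul_left_cancel₀ hp0 ?_)
      rw [hp.2, e1, hp'.2]
  have hKinv : ∀ a, ∀ u ∈ U, K (a * u) = K a := fun a u hu => by
    have hu' := mU.1 hu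
    have hu0 : u ≠ 0 := fun h => by
      rw [h, zero_pow (Nat.succ_ne_zero _)] at hu'
      exact zero_ne_one hu'
    refine Finset.sum_nbij' (fun z => u * z) (fun z => u⁻¹ * z) (fun z hz => ?_) (fun z hz => ?_)
      (fun z _ => ?_) (fun z _ => ?_) (fun z _ => by rw [mul_assoc])
    · rw [mU, mul_pow, hu', mU.1 hz, one_mul]
    · rw [mU, mul_pow, inv_pow, hu', mU.1 hz, inv_one, one_mul]
    · field_simp
    · field_simp
  have fourthL : ((q : ℤ) ^ n + 1) * ∑ a ∈ L', K a ^ 4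
      ≤ (q + 1) * ((q ^ n) ^ 2 * (3 * (q ^ n + 1) ^ 2) - (q ^ n + 1) ^ 4) := by
    have h1 : ((q : ℤ) ^ n + 1) * ∑ a ∈ L', K a ^ 4
        = ∑ p ∈ L' ×ˢ U, K (p.1 * p.2) ^ 4 := by
      rw [Finset.sum_product, Finset.mul_sum]
      refine Finset.sum_congr rfl fun a _ => ?_
      rw [Finset.sum_congr rfl fun u hu => by rw [hKinv a u hu], Finset.sum_const, cU]
      simp
    have h2 : ∀ p ∈ L' ×ˢ U, p.1 * p.2 ∈ Finset.univ.erase (0 : F) := fun p hp => by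
      rw [Finset.mem_product] at hp
      refine Finset.mem_erase.2 ⟨mul_ne_zero (fun h => hz0 (h ▸ hp.1)) fun h => ?_,
        Finset.mem_univ _⟩
      have := mU.1 hp.2
      rw [h, zero_pow (Nat.succ_ne_zero _)] at this
      exact zero_ne_one this
    rw [h1, ← Finset.sum_fiberwise_of_maps_to h2]
    calc _ ≤ ∑ x ∈ Finset.univ.erase (0 : F), ((q : ℤ) + 1) * K x ^ 4 := by
          refine Finset.sum_le_sum fun x _ => ?_
          rw [Finset.sum_congr rfl (g := fun _ => K x ^ 4) fun p hp => by
            rw [(Finset.mem_filter.1 hp).2], Finset.sum_const, nsmul_eq_mul]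
          gcongr
          exact_mod_cast fiber x
      _ = (q + 1) * (∑ x : F, K x ^ 4 - (q ^ n + 1) ^ 4) := by
          rw [← Finset.mul_sum, ← Finset.add_sum_erase _ _ (Finset.mem_univ (0 : F)), K0]
          ring
      _ ≤ _ := by
          gcongr
          refine fourth.trans (le_of_eq ?_)
          rw [← pow_mul, mul_comm 2 n]
  rw [hL, Finset.sum_insert hz0, K0, k0] at cross
  rw [hL, Finset.sum_insert hz0, k0] at second
  refine moment_bounds_incompatible (q := q) (Q := q ^ n) (A := ∑ a ∈ L', K a * k a)
    (B := ∑ a ∈ L', k a ^ 2) (C := ∑ a ∈ L', K a ^ 2) (D := ∑ a ∈ L', K a ^ 4)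
    (by exact_mod_cast hq2) ?_ (by linarith) (Finset.sum_mul_sq_le_sq_mul_sq _ _ _)
    (by linarith) ?_ fourthL
  · exact pow_le_pow_right₀ (by exact_mod_cast (by omega : 1 ≤ q)) hn7
  · have h := sq_sum_le_card_mul_sum_sq (s := L') (f := fun a => K a ^ 2)
    rw [cL', Nat.cast_sub (by omega)] at h
    simpa [← pow_mul] using h

/-- A monic quadratic with coefficients fixed by `x ↦ x ^ q` has a root fixed by `x ↦ x ^ q ^ 2`. -/
theorem exists_root_quadratic {F : Type*} [Field F] [Fintype F] [CharP F 2] {d q n : ℕ}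
    (hq : q = 2 ^ d) (hF : Fintype.card F = q ^ (2 * n)) {b c : F} (hb : b ^ q = b)
    (hc : c ^ q = c) : ∃ w : F, w ^ 2 + b * w + c = 0 ∧ w ^ (q ^ 2) = w := by
  classical
  let E := AlgebraicClosure F
  let i := algebraMap F E
  have : CharP E 2 := charP_of_injective_algebraMap (algebraMap F E).injective 2
  obtain ⟨y, hy⟩ : ∃ y : E, y ^ 2 + i b * y + i c = 0 := by
    obtain ⟨y, hy⟩ := IsAlgClosed.exists_root
      (Polynomial.X ^ 2 + Polynomial.C (i b) * Polynomial.X + Polynomial.C (i c)) (by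
        have := Polynomial.degree_quadratic (a := (1 : E)) (b := i b) (c := i c) one_ne_zero
        simp only [map_one, one_mul] at this
        rw [this]; norm_num)
    exact ⟨y, by simpa [Polynomial.IsRoot] using hy⟩
  have hib : i b ^ q = i b := by rw [← map_pow, hb]
  have hic : i c ^ q = i c := by rw [← map_pow, hc]
  have hfrob : ∀ x z : E, (x + z) ^ q = x ^ q + z ^ q := fun x z => by
    rw [hq, add_pow_char_pow]
  have hq0 : q ≠ 0 := by rw [hq]; positivity
  have hyq : (y ^ q) ^ 2 + i b * y ^ q + i c = 0 := by
    have := congrArg (· ^ q) hy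
    simp only [hfrob, mul_pow, hib, hic, zero_pow hq0] at this
    rw [← this]; ring
  have hy2 : y ^ (q ^ 2) = y := by
    have two : (2 : E) = 0 := CharTwo.two_eq_zero
    have h : (y ^ q + y) * (y ^ q + (y + i b)) = 0 := by
      linear_combination hyq + hy + (y * y ^ q - i c) * two
    rw [sq q, pow_mul]
    rcases mul_eq_zero.1 h with h | h <;> rw [CharTwo.add_eq_zero] at h
    · rw [h, h]
    · rw [h, hfrob, h, hib, add_assoc, CharTwo.add_self_eq_zero, add_zero]
  have hyF : y ^ Fintype.card F = y := by
    rw [hF, pow_mul]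
    rw [pow_sq_pow_of_pow_sq_eq hy2]
  have hmem : y ∈ Set.range i := by
    by_contra hy'
    let p : Polynomial E := Polynomial.X ^ Fintype.card F - Polynomial.X
    have hp0 : p ≠ 0 := FiniteField.X_pow_card_sub_X_ne_zero E Fintype.one_lt_card
    have hsub : insert y (Finset.univ.image i) ⊆ p.roots.toFinset := fun x hx => by
      rw [Multiset.mem_toFinset, Polynomial.mem_roots hp0]
      rw [Finset.mem_insert, Finset.mem_image] at hx
      rcases hx with rfl | ⟨a, -, rfl⟩
      · simp [p, hyF]
      · simp [p, ← map_pow, FiniteField.pow_card]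
    have h1 := (Finset.card_le_card hsub).trans
      ((Multiset.toFinset_card_le _).trans p.card_roots')
    rw [FiniteField.X_pow_card_sub_X_natDegree_eq E Fintype.one_lt_card,
      Finset.card_insert_of_notMem (by simpa using hy'),
      Finset.card_image_of_injective _ i.injective, Finset.card_univ] at h1
    omega
  obtain ⟨w, rfl⟩ := hmem
  exact ⟨w, i.injective (by simpa using hy), i.injective (by simpa using hy2)⟩

theorem card_filter_pow_eq_self {F : Type*} [Field F] [Fintype F] [DecidableEq F] {N : ℕ}
    (hN : 2 ≤ N) (h : N - 1 ∣ Fintype.card F - 1) :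
    (Finset.univ.filter fun x : F => x ^ N = x).card = N := by
  have e : (Finset.univ.filter fun x : F => x ^ N = x)
      = insert 0 (Polynomial.nthRootsFinset (N - 1) (1 : F)) := by
    ext x
    obtain ⟨c, rfl⟩ : ∃ c, N = c + 1 := ⟨N - 1, by omega⟩
    rw [Finset.mem_insert, Polynomial.mem_nthRootsFinset (by omega)]
    rcases eq_or_ne x 0 with rfl | hx
    · simp
    · simp [hx, pow_succ]
  rw [e, Finset.card_insert_of_notMem, card_nthRootsFinset_one_of_dvd h]
  · omega
  · rw [Polynomial.mem_nthRootsFinset (by omega), zero_pow (by omega)]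
    exact zero_ne_one

/-- In characteristic two the logarithmic derivative of a quintic has a quartic numerator that is
a polynomial in `w ^ 2`. -/
theorem sum_five_inv_eq_zero_iff {F : Type*} [Field F] [CharP F 2] {w a b c e f : F}
    (ha : a + w ≠ 0) (hb : b + w ≠ 0) (hc : c + w ≠ 0) (he : e + w ≠ 0) (hf : f + w ≠ 0) :
    (a + w)⁻¹ + (b + w)⁻¹ + (c + w)⁻¹ + (e + w)⁻¹ + (f + w)⁻¹ = 0 ↔
      w ^ 4 + (a * b + a * c + a * e + a * f + b * c + b * e + b * f + c * e + c * f + e * f)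
        * w ^ 2 + (a * b * c * e + a * b * c * f + a * b * e * f + a * c * e * f + b * c * e * f)
        = 0 := by
  have two : (2 : F) = 0 := CharTwo.two_eq_zero
  have hP : (a + w) * (b + w) * (c + w) * (e + w) * (f + w) ≠ 0 := by
    simp [ha, hb, hc, he, hf]
  have key : (a + w) * (b + w) * (c + w) * (e + w) * (f + w) *
      ((a + w)⁻¹ + (b + w)⁻¹ + (c + w)⁻¹ + (e + w)⁻¹ + (f + w)⁻¹) =
      w ^ 4 + (a * b + a * c + a * e + a * f + b * c + b * e + b * f + c * e + c * f + e * f)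
        * w ^ 2 + (a * b * c * e + a * b * c * f + a * b * e * f + a * c * e * f + b * c * e * f)
      := by
    field_simp
    linear_combination (2 * w ^ 4 + 2 * (a + b + c + e + f) * w ^ 3
      + (a * b + a * c + a * e + a * f + b * c + b * e + b * f + c * e + c * f + e * f) * w ^ 2
      + (a * b * c + a * b * e + a * b * f + a * c * e + a * c * f + a * e * f + b * c * e
        + b * c * f + b * e * f + c * e * f) * w) * two
  rw [← key, mul_eq_zero, or_iff_right hP]

section Quintic

variable {F : Type*} [Field F]

/-- The sum of the first five conjugates under `x ↦ x ^ q`. -/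
def conjSum (q : ℕ) (t : F) : F := t + t ^ q + t ^ q ^ 2 + t ^ q ^ 3 + t ^ q ^ 4

/-- The second elementary symmetric function of the first five conjugates. -/
def conjE₂ (q : ℕ) (t : F) : F :=
  t * t ^ q + t * t ^ q ^ 2 + t * t ^ q ^ 3 + t * t ^ q ^ 4 + t ^ q * t ^ q ^ 2
    + t ^ q * t ^ q ^ 3 + t ^ q * t ^ q ^ 4 + t ^ q ^ 2 * t ^ q ^ 3 + t ^ q ^ 2 * t ^ q ^ 4
    + t ^ q ^ 3 * t ^ q ^ 4

/-- The fourth elementary symmetric function of the first five conjugates. -/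
def conjE₄ (q : ℕ) (t : F) : F :=
  t * t ^ q * t ^ q ^ 2 * t ^ q ^ 3 + t * t ^ q * t ^ q ^ 2 * t ^ q ^ 4
    + t * t ^ q * t ^ q ^ 3 * t ^ q ^ 4 + t * t ^ q ^ 2 * t ^ q ^ 3 * t ^ q ^ 4
    + t ^ q * t ^ q ^ 2 * t ^ q ^ 3 * t ^ q ^ 4

theorem pow_pow_eq_self {q : ℕ} {w : F} (hw : w ^ q = w) (j : ℕ) : w ^ q ^ j = w := by
  induction j with
  | zero => simp
  | succ m ih => rw [pow_succ, pow_mul, ih, hw]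

variable [CharP F 2] {d q : ℕ}

theorem add_pow_pow (hq : q = 2 ^ d) (x y : F) (j : ℕ) :
    (x + y) ^ q ^ j = x ^ q ^ j + y ^ q ^ j := by
  rw [hq, ← pow_mul, add_pow_char_pow]

theorem add_pow_self (hq : q = 2 ^ d) (x y : F) : (x + y) ^ q = x ^ q + y ^ q := by
  simpa using add_pow_pow hq x y 1

theorem conjSum_add (hq : q = 2 ^ d) (x y : F) :
    conjSum q (x + y) = conjSum q x + conjSum q y := by
  simp only [conjSum, add_pow_pow hq, add_pow_self hq]
  ring

theorem conjSum_of_fixed {w : F} (hw : w ^ q = w) : conjSum q w = w := by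
  have two : (2 : F) = 0 := CharTwo.two_eq_zero
  simp only [conjSum, pow_pow_eq_self hw, hw]
  linear_combination 2 * w * two

theorem conjE₂_add (hq : q = 2 ^ d) (x y : F) :
    conjE₂ q (x + y) = conjE₂ q x + conjE₂ q y + conjSum q x * conjSum q y
      - conjSum q (x * y) := by
  simp only [conjSum, conjE₂, add_pow_pow hq, add_pow_self hq, mul_pow]
  ring

theorem conjE₂_of_fixed {w : F} (hw : w ^ q = w) : conjE₂ q w = 0 := by
  have two : (2 : F) = 0 := CharTwo.two_eq_zero
  simp only [conjE₂, pow_pow_eq_self hw, hw]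
  linear_combination 5 * w ^ 2 * two

theorem conjSum_pow (hq : q = 2 ^ d) {t : F} (ht : t ^ q ^ 5 = t) :
    conjSum q t ^ q = conjSum q t := by
  simp only [conjSum, add_pow_self hq, ← pow_mul, ← pow_succ, ← sq]
  rw [ht]; ring

theorem conjE₂_pow (hq : q = 2 ^ d) {t : F} (ht : t ^ q ^ 5 = t) :
    conjE₂ q t ^ q = conjE₂ q t := by
  simp only [conjE₂, add_pow_self hq, mul_pow, ← pow_mul, ← pow_succ, ← sq]
  rw [ht]; ring

theorem conjE₄_pow (hq : q = 2 ^ d) {t : F} (ht : t ^ q ^ 5 = t) :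
    conjE₄ q t ^ q = conjE₄ q t := by
  simp only [conjE₄, add_pow_self hq, mul_pow, ← pow_mul, ← pow_succ, ← sq]
  rw [ht]; ring

theorem conjSum_inv_add_eq_zero_iff (hq : q = 2 ^ d) {t w : F} (hw : w ^ q = w)
    (h : t + w ≠ 0) : conjSum q (t + w)⁻¹ = 0 ↔
      w ^ 4 + conjE₂ q t * w ^ 2 + conjE₄ q t = 0 := by
  have h' : ∀ j, t ^ q ^ j + w ≠ 0 := fun j => by
    have := pow_ne_zero (q ^ j) h
    rwa [add_pow_pow hq, pow_pow_eq_self hw] at this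
  have h1 := h' 1
  rw [pow_one] at h1
  simp only [conjSum, inv_pow, add_pow_pow hq, add_pow_self hq, pow_pow_eq_self hw, hw]
  exact sum_five_inv_eq_zero_iff h h1 (h' 2) (h' 3) (h' 4)

/-- The second symmetric function does not vanish identically off the base field. -/
theorem exists_conjE₂_ne_zero (hq : q = 2 ^ d) {l : F} (hl : l ^ q ^ 5 = l) (hlq : l ^ q ≠ l) :
    ∃ t : F, t ^ q ^ 5 = t ∧ conjE₂ q t ≠ 0 := by
  by_contra! hcon
  set t := l + conjSum q l with ht
  have hS := conjSum_pow hq hl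
  have ht5 : t ^ q ^ 5 = t := by rw [ht, add_pow_pow hq, hl, pow_pow_eq_self hS]
  have ht0 : t ≠ 0 := fun h => by
    rw [ht, CharTwo.add_eq_zero] at h
    exact hlq (by rw [h, hS])
  have hSt : conjSum q t = 0 := by
    rw [ht, conjSum_add hq, conjSum_of_fixed hS, CharTwo.add_self_eq_zero]
  have hti : t⁻¹ ^ q ^ 5 = t⁻¹ := by rw [inv_pow, ht5]
  have h := conjE₂_add hq t t⁻¹
  rw [hcon _ (by rw [add_pow_pow hq, ht5, hti]), hcon _ ht5, hcon _ hti, hSt,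
    mul_inv_cancel₀ ht0, conjSum_of_fixed (one_pow q)] at h
  simp at h

/-- By double counting, some quintic element has a quartic without roots in the base field. -/
theorem exists_conjSum_inv_ne_zero [Fintype F] (hd : 0 < d) (hq : q = 2 ^ d)
    (hF : Fintype.card F = q ^ (2 * 5)) :
    ∃ t : F, t ^ q ^ 5 = t ∧ t ^ q ≠ t ∧ ∀ w : F, w ^ q = w → conjSum q (t + w)⁻¹ ≠ 0 := by
  classical
  by_contra! hcon
  have hq2 : 2 ≤ q := by rw [hq]; exact Nat.le_self_pow hd.ne' 2
  set k := Finset.univ.filter fun x : F => x ^ q = x with hk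
  set L := Finset.univ.filter fun x : F => x ^ q ^ 5 = x with hL
  set Z := L.filter fun x => conjSum q x = 0 with hZ
  have ck : k.card = q := card_filter_pow_eq_self hq2 (by
    rw [hF]; simpa using Nat.sub_dvd_pow_sub_pow q 1 10)
  have cL : L.card = q ^ 5 := card_filter_pow_eq_self (hq2.trans (Nat.le_self_pow (by norm_num) q))
    (by rw [hF, mul_comm, pow_mul]; simpa using Nat.sub_dvd_pow_sub_pow (q ^ 5) 1 2)
  have mk : ∀ {x}, x ∈ k ↔ x ^ q = x := by simp [hk]
  have mL : ∀ {x}, x ∈ L ↔ x ^ q ^ 5 = x := by simp [hL]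
  have hkL : k ⊆ L := fun x hx => mL.2 (pow_pow_eq_self (mk.1 hx) 5)
  have cLk : (L \ k).card = q ^ 5 - q := by rw [Finset.card_sdiff_of_subset hkL, cL, ck]
  have cZ : Z.card * q ≤ q ^ 5 := by
    rw [← cL, ← ck, ← Finset.card_product]
    refine Finset.card_le_card_of_injOn (fun p => p.1 + p.2) (fun p hp => ?_) fun p hp p' hp' h => ?_
    · simp only [Finset.coe_product, Set.mem_prod, Finset.mem_coe, hZ, Finset.mem_filter] at hp
      refine mL.2 ?_
      rw [add_pow_pow hq, mL.1 hp.1.1, pow_pow_eq_self (mk.1 hp.2)]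
    · simp only [Finset.coe_product, Set.mem_prod, Finset.mem_coe, hZ, Finset.mem_filter] at hp hp'
      have h' := congrArg (conjSum q) h
      simp only [conjSum_add hq, hp.1.2, hp'.1.2, conjSum_of_fixed (mk.1 hp.2),
        conjSum_of_fixed (mk.1 hp'.2), zero_add] at h'
      refine Prod.ext ?_ h'
      simpa [h'] using h
  set W := ((L \ k) ×ˢ k).filter fun p => conjSum q (p.1 + p.2)⁻¹ = 0 with hW
  have mW : ∀ {p}, p ∈ W ↔ ((p.1 ^ q ^ 5 = p.1 ∧ p.1 ^ q ≠ p.1) ∧ p.2 ^ q = p.2) ∧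
      conjSum q (p.1 + p.2)⁻¹ = 0 := by simp [hW, mL, mk]
  have hne : ∀ t w : F, t ^ q ≠ t → w ^ q = w → t + w ≠ 0 := fun t w ht hw h => by
    rw [CharTwo.add_eq_zero] at h
    exact ht (h ▸ hw)
  have cW : W.card ≤ (L \ k).card := by
    have h0 : (0 : F) ∈ Z := by
      have : q ≠ 0 := by omega
      rw [hZ, Finset.mem_filter, mL]
      simp [conjSum, this]
    have h1 : W.card ≤ ((Z.erase 0) ×ˢ k).card := by
      refine Finset.card_le_card_of_injOn (fun p => ((p.1 + p.2)⁻¹, p.2)) (fun p hp => ?_)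
        fun p hp p' hp' h => ?_
      · obtain ⟨⟨⟨h5, hn⟩, hw⟩, hs⟩ := mW.1 hp
        simp only [Finset.coe_product, Set.mem_prod, Finset.mem_coe, hZ, Finset.mem_filter,
          Finset.mem_erase, mL, mk]
        refine ⟨⟨inv_ne_zero (hne _ _ hn hw), ?_, hs⟩, hw⟩
        rw [inv_pow, add_pow_pow hq, h5, pow_pow_eq_self hw]
      · simp only [Prod.mk.injEq, inv_inj] at h
        refine Prod.ext ?_ h.2
        simpa [h.2] using h.1
    rw [Finset.card_product, Finset.card_erase_of_mem h0, ck, Nat.sub_mul, one_mul] at h1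
    rw [cLk]
    omega
  have hinj := Finset.inj_on_of_surj_on_of_card_le (s := W) (t := L \ k) (fun p _ => p.1)
    (fun p hp => (Finset.mem_product.1 (Finset.mem_filter.1 hp).1).1) (fun t ht => by
      rw [Finset.mem_sdiff, mL, mk] at ht
      obtain ⟨w, hw, h⟩ := hcon t ht.1 ht.2
      exact ⟨(t, w), mW.2 ⟨⟨ht, hw⟩, h⟩, rfl⟩) cW
  obtain ⟨l, hl⟩ : (L \ k).Nonempty := by
    rw [← Finset.card_pos, cLk]
    have : q < q ^ 5 := lt_self_pow₀ hq2 (by norm_num)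
    omega
  rw [Finset.mem_sdiff, mL, mk] at hl
  obtain ⟨t, ht, hE⟩ := exists_conjE₂_ne_zero hq hl.1 hl.2
  have htq : t ^ q ≠ t := fun h => hE (conjE₂_of_fixed h)
  obtain ⟨w, hw, h⟩ := hcon t ht htq
  set b := conjE₂ q t ^ 2 ^ (d - 1) with hb
  have hb2 : b ^ 2 = conjE₂ q t := by
    rw [hb, ← pow_mul, ← pow_succ, Nat.sub_add_cancel hd, ← hq, conjE₂_pow hq ht]
  have hb0 : b ≠ 0 := pow_ne_zero _ hE
  have hbq : b ^ q = b := by rw [hb, ← pow_mul, mul_comm, pow_mul, conjE₂_pow hq ht]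
  have hwb : (w + b) ^ q = w + b := by rw [add_pow_self hq, hw, hbq]
  have h2 : conjSum q (t + (w + b))⁻¹ = 0 := by
    rw [conjSum_inv_add_eq_zero_iff hq hwb (hne _ _ htq hwb)]
    rw [conjSum_inv_add_eq_zero_iff hq hw (hne _ _ htq hw), ← hb2] at h
    have two : (2 : F) = 0 := CharTwo.two_eq_zero
    rw [← hb2]
    linear_combination h + (2 * w ^ 3 * b + 3 * w ^ 2 * b ^ 2 + 2 * w * b ^ 3
      + w * b ^ 3 + b ^ 4) * two
  have := hinj (mW.2 ⟨⟨⟨ht, htq⟩, hw⟩, h⟩ : (t, w) ∈ W)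
    (mW.2 ⟨⟨⟨ht, htq⟩, hwb⟩, h2⟩ : (t, w + b) ∈ W) rfl
  simp [hb0] at this

theorem exists_trSq_five_eq_one [Fintype F] (hd : 0 < d) (hq : q = 2 ^ d)
    (hF : Fintype.card F = q ^ (2 * 5)) :
    ∃ z : F, z ^ (q ^ 5 + 1) = 1 ∧ trSq q 5 z = 1 ∧ z ≠ 1 := by
  obtain ⟨t, ht, htq, hS⟩ := exists_conjSum_inv_ne_zero hd hq hF
  have two : (2 : F) = 0 := CharTwo.two_eq_zero
  have sqrt : ∀ x : F, x ^ q = x → ∃ y : F, y ^ q = y ∧ y ^ 2 = x := fun x hx =>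
    ⟨x ^ 2 ^ (d - 1), by rw [← pow_mul, mul_comm, pow_mul, hx],
      by rw [← pow_mul, ← pow_succ, Nat.sub_add_cancel hd, ← hq, hx]⟩
  obtain ⟨b, hb, hb2⟩ := sqrt _ (conjE₂_pow hq ht)
  obtain ⟨c, hc, hc2⟩ := sqrt _ (conjE₄_pow hq ht)
  obtain ⟨w, hw, hw2⟩ := exists_root_quadratic hq hF hb hc
  have hquart : w ^ 4 + conjE₂ q t * w ^ 2 + conjE₄ q t = 0 := by
    rw [← hb2, ← hc2]
    linear_combination (w ^ 2 + b * w + c) * hw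
      - (b * w ^ 3 + c * w ^ 2 + b * c * w) * two
  have hwq : w ^ q ≠ w := fun h => by
    have hne : t + w ≠ 0 := fun h' => by
      rw [CharTwo.add_eq_zero] at h'
      exact htq (h' ▸ h)
    exact hS w h ((conjSum_inv_add_eq_zero_iff hq h hne).2 hquart)
  have hw5 : w ^ q ^ 5 = w ^ q := by
    rw [show q ^ 5 = q * (q ^ 2) ^ 2 by ring, pow_mul, pow_sq_pow_of_pow_sq_eq]
    rw [← pow_mul, mul_comm, pow_mul, hw2]
  have hwq5 : (w ^ q) ^ q ^ 5 = w := by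
    rw [← pow_mul, mul_comm, pow_mul, hw5, ← pow_mul, ← sq, hw2]
  have hne : t + w ≠ 0 := fun h => by
    rw [CharTwo.add_eq_zero] at h
    subst h
    exact hwq (hw5.symm.trans ht)
  have hne' : t + w ^ q ≠ 0 := fun h => by
    have := pow_ne_zero (q ^ 5) hne
    rw [add_pow_pow hq, ht, hw5] at this
    exact this h
  refine ⟨(t + w ^ q) * (t + w)⁻¹, ?_, ?_, ?_⟩
  · rw [pow_succ, mul_pow, inv_pow, add_pow_pow hq, add_pow_pow hq, ht, hw5, hwq5]
    field_simp
  · have hw' : ∀ j, w ^ (q ^ 2) ^ j = w := pow_sq_pow_of_pow_sq_eq hw2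
    have hv : (w ^ q + w) ^ q ^ 2 = w ^ q + w := by
      rw [add_pow_pow hq, hw2, ← pow_mul, mul_comm, pow_mul, hw2]
    have e : (t + w ^ q) * (t + w)⁻¹ = 1 + (w ^ q + w) * (t + w)⁻¹ := by
      field_simp
      linear_combination -w * two
    have hinv : trSq q 5 (t + w)⁻¹ = 0 := by
      have h6 : t ^ q ^ 6 = t ^ q := by rw [pow_succ, pow_mul, ht]
      have h8 : t ^ q ^ 8 = t ^ q ^ 3 := by
        rw [show q ^ 8 = q ^ 5 * q ^ 3 by ring, pow_mul, ht]
      have hj : ∀ j, ((t + w)⁻¹) ^ (q ^ 2) ^ j = (t ^ q ^ (2 * j) + w)⁻¹ := fun j => by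
        rw [inv_pow, pow_mul q, ← hw' j, ← pow_mul q, add_pow_pow hq, pow_mul q, hw' j, hw' j]
      have hj0 : ∀ j, t ^ q ^ (2 * j) + w ≠ 0 := fun j => by
        have := pow_ne_zero ((q ^ 2) ^ j) (inv_ne_zero hne)
        rw [hj] at this
        exact fun h => this (by rw [h, inv_zero])
      have h0 := hj0 0
      have h1 := hj0 1
      have h2 := hj0 2
      have h3 := hj0 3
      have h4 := hj0 4
      norm_num [h6, h8] at h0 h1 h2 h3 h4
      have := (sum_five_inv_eq_zero_iff h0 h3 h1 h4 h2).2 hquart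
      simp only [trSq, Finset.sum_range_succ, hj, Finset.sum_range_zero]
      norm_num [h6, h8]
      rw [← this]; ring
    rw [e, trSq_add hq, trSq_one q (by decide), trSq_mul 5 hv, hinv, mul_zero, add_zero]
  · intro h
    rw [mul_inv_eq_one₀ hne] at h
    exact hwq (add_left_cancel h)

end Quintic


/-- Lemma 3.4: for `q = 2^d` even, `n ≥ 5` odd, `(q,n) ≠ (2,5)`,
there exists `z ∈ F_{q^{2n}}` with `z^{q^n+1} = 1`, `Tr_{F_{q^{2n}}/F_{q^2}}(z) = 1`
and `z ≠ 1`. -/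
theorem stmt11 (d q n : ℕ) (hd : 0 < d) (hq : q = 2 ^ d)
    (hn : Odd n) (hn5 : 5 ≤ n) (hne : ¬ (q = 2 ∧ n = 5))
    {F : Type*} [Field F] [Fintype F] (hF : Fintype.card F = q ^ (2 * n)) :
    ∃ z : F, z ^ (q ^ n + 1) = 1 ∧ (∑ i ∈ Finset.range n, z ^ ((q ^ 2) ^ i)) = 1
      ∧ z ≠ 1 := by
  have : CharP F 2 := charP_of_card_eq_prime_pow (p := 2) (f := d * (2 * n)) (by
    rw [hF, hq, ← pow_mul])
  rcases hn5.eq_or_lt with rfl | hn5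
  · exact exists_trSq_five_eq_one hd hq hF
  · have hn7 : 7 ≤ n := by
      obtain ⟨k, rfl⟩ := hn
      omega
    exact exists_trSq_eq_one_of_seven_le hd hq hn hn7 hF
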